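/- Let N ≥ 2, ζ_{2N} = exp(πi/N). For each k ∈ {1,...,N} and each m ∈ {1,...,N}, ∑_{n≠m, 1≤n≤N} [sin(π/N)/sin(π(m-n)/N)] · ζ_{2N}^{n(2k-1)} = (ζ_{2N} - ζ_{2N}^{-1}) · ζ_{2N}^{m(2k-1)} · (k - (N+1)/2). That is, the vector (ζ_{2N}^{m(2k-1)})_m is an eigenvector of A_N^quant with eigenvalue 2i·sin(π/N)·(k - (N+1)/2). -/

import Mathlib

open Complex Finset Matrix

/-- If the `a n` are `N`-th roots of unity different from `1` whose power sums of exponents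
`1, …, N - 1` all equal `-1`, then `∑ a n ^ k / (1 - a n)` is an explicit affine function of `k`. -/
theorem sum_pow_div_one_sub_of_power_sums {ι : Type*} (s : Finset ι) (a : ι → ℂ) (N : ℕ)
    (h_ne : ∀ n ∈ s, a n ≠ 1) (h_root : ∀ n ∈ s, a n ^ N = 1)
    (h_sum : ∀ k, 1 ≤ k → k < N → ∑ n ∈ s, a n ^ k = -1) (k : ℕ) (hk1 : 1 ≤ k) (hk2 : k ≤ N) :
    ∑ n ∈ s, a n ^ k / (1 - a n) = (k : ℂ) - ((N : ℂ) + 1) / 2 := by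
  set S : ℕ → ℂ := fun k => ∑ n ∈ s, a n ^ (k + 1) / (1 - a n) with hS
  have step : ∀ j, j + 1 < N → S (j + 1) = S j + 1 := by
    intro j hj
    have h : S j - S (j + 1) = ∑ n ∈ s, a n ^ (j + 1) := by
      rw [hS, ← Finset.sum_sub_distrib]
      refine Finset.sum_congr rfl fun n hn => ?_
      have h1 : 1 - a n ≠ 0 := sub_ne_zero.mpr (h_ne n hn).symm
      field_simp
      ring
    rw [h_sum (j + 1) (by omega) hj] at h
    linear_combination -h
  have affine : ∀ j, j < N → S j = S 0 + j := by
    intro j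
    induction j with
    | zero => simp
    | succ j ih =>
      intro hj
      rw [step j hj, ih (by omega)]
      push_cast
      ring
  have total : ∑ j ∈ Finset.range N, S j = 0 := by
    rw [hS, Finset.sum_comm]
    refine Finset.sum_eq_zero fun n hn => ?_
    rw [← Finset.sum_div]
    simp_rw [pow_succ]
    rw [← Finset.sum_mul, geom_sum_eq (h_ne n hn), h_root n hn]
    simp
  have gauss : ∀ M : ℕ, ∑ j ∈ Finset.range M, (j : ℂ) = M * (M - 1) / 2 := by
    intro M
    induction M with
    | zero => simp
    | succ M ih =>
      rw [Finset.sum_range_succ, ih]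
      push_cast
      ring
  rw [Finset.sum_congr rfl fun j hj => affine j (Finset.mem_range.mp hj),
    Finset.sum_add_distrib, gauss] at total
  simp only [Finset.sum_const, Finset.card_range, nsmul_eq_mul] at total
  have hN : (N : ℂ) ≠ 0 := by
    norm_cast
    omega
  have h0 : S 0 = -((N : ℂ) - 1) / 2 := by
    apply mul_left_cancel₀ hN
    linear_combination total
  obtain ⟨j, rfl⟩ := Nat.exists_eq_add_of_le' hk1
  change S j = _
  rw [affine j (by omega), h0]
  push_cast
  ring

theorem IsPrimitiveRoot.sum_Icc_pow_pow_eq_zero {w : ℂ} {N : ℕ} (hw : IsPrimitiveRoot w N)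
    (k : ℕ) (hk1 : 1 ≤ k) (hk2 : k < N) : ∑ n ∈ Finset.Icc 1 N, (w ^ n) ^ k = 0 := by
  have h1 : w ^ k ≠ 1 := hw.pow_ne_one_of_pos_of_lt (by omega) hk2
  rw [← Finset.Ico_succ_right_eq_Icc, Order.succ_eq_add_one, ← Finset.sum_Ico_add' _ 0 N 1,
    Nat.Ico_zero_eq_range]
  have h2 : ∀ n ∈ Finset.range N, (w ^ (n + 1)) ^ k = (w ^ k) ^ n * w ^ k := by
    intro n _
    ring
  rw [Finset.sum_congr rfl h2, ← Finset.sum_mul, geom_sum_eq h1, ← pow_mul, mul_comm k N,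
    pow_mul, hw.pow_eq_one]
  simp

theorem IsPrimitiveRoot.sum_erase_pow_div_one_sub {w : ℂ} {N : ℕ} (hw : IsPrimitiveRoot w N)
    (m : ℕ) (hm : m ∈ Finset.Icc 1 N) (k : ℕ) (hk1 : 1 ≤ k) (hk2 : k ≤ N) :
    ∑ n ∈ (Finset.Icc 1 N).erase m, (w ^ n / w ^ m) ^ k / (1 - w ^ n / w ^ m) =
      (k : ℂ) - ((N : ℂ) + 1) / 2 := by
  have hw0 : w ≠ 0 := hw.ne_zero (by omega)
  refine sum_pow_div_one_sub_of_power_sums _ (fun n => w ^ n / w ^ m) N ?_ ?_ ?_ k hk1 hk2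
  · intro n hn h
    rw [div_eq_one_iff_eq (pow_ne_zero _ hw0)] at h
    simp only [Finset.mem_erase, Finset.mem_Icc] at hn hm
    obtain ⟨i, rfl⟩ := Nat.exists_eq_add_of_le' hn.2.1
    obtain ⟨j, rfl⟩ := Nat.exists_eq_add_of_le' hm.1
    rw [pow_succ, pow_succ] at h
    have := hw.pow_inj (by omega) (by omega) (mul_right_cancel₀ hw0 h)
    omega
  · intro n _
    rw [div_pow, ← pow_mul, ← pow_mul, mul_comm n, mul_comm m, pow_mul, pow_mul, hw.pow_eq_one]
    simp
  · intro j hj1 hj2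
    rw [Finset.sum_erase_eq_sub hm]
    simp_rw [div_pow _ _ j]
    rw [← Finset.sum_div, hw.sum_Icc_pow_pow_eq_zero j hj1 hj2,
      div_self (pow_ne_zero _ (pow_ne_zero _ hw0))]
    simp

theorem two_I_mul_sin_eq_exp_sub_inv (x : ℂ) :
    2 * Complex.I * Complex.sin x = Complex.exp (x * Complex.I) - (Complex.exp (x * Complex.I))⁻¹ := by
  rw [← Complex.exp_neg, Complex.sin, neg_mul]
  linear_combination (Complex.exp (-(x * Complex.I)) - Complex.exp (x * Complex.I)) * Complex.I_sq

theorem sin_div_sin_eq_exp_ratio (N m n : ℕ) (ζ : ℂ)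
    (hζ : ζ = Complex.exp ((Real.pi : ℂ) * Complex.I / N)) :
    ((Real.sin (Real.pi / N) / Real.sin (Real.pi * ((m : ℝ) - (n : ℝ)) / N) : ℝ) : ℂ) =
      (ζ - ζ⁻¹) / (ζ ^ m / ζ ^ n - ζ ^ n / ζ ^ m) := by
  have h1 : Complex.exp ((Real.pi : ℂ) / N * Complex.I) = ζ := by
    rw [hζ]
    ring_nf
  have h2 : Complex.exp ((Real.pi : ℂ) * ((m : ℂ) - n) / N * Complex.I) = ζ ^ m / ζ ^ n := by
    rw [hζ, ← Complex.exp_nat_mul, ← Complex.exp_nat_mul, ← Complex.exp_sub]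
    ring_nf
  have h3 := two_I_mul_sin_eq_exp_sub_inv ((Real.pi : ℂ) / N)
  have h4 := two_I_mul_sin_eq_exp_sub_inv ((Real.pi : ℂ) * ((m : ℂ) - n) / N)
  rw [h1] at h3
  rw [h2, inv_div] at h4
  rw [← h3, ← h4, mul_div_mul_left _ _ (by simp)]
  push_cast
  rfl

theorem sum_quant_alternating_hilbert_eq (N : ℕ) (ζ : ℂ)
    (hζ : ζ = Complex.exp ((Real.pi : ℂ) * Complex.I / N))
    (k : ℕ) (hk1 : 1 ≤ k) (hk2 : k ≤ N) (m : ℕ) (hm : m ∈ Finset.Icc 1 N) :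
    ∑ n ∈ (Finset.Icc 1 N).erase m,
        ((Real.sin (Real.pi / N) / Real.sin (Real.pi * ((m : ℝ) - (n : ℝ)) / N) : ℝ) : ℂ) *
          ζ ^ (n * (2 * k - 1)) =
      (ζ - ζ⁻¹) * ζ ^ (m * (2 * k - 1)) * ((k : ℂ) - ((N : ℂ) + 1) / 2) := by
  have hw : IsPrimitiveRoot (ζ ^ 2) N := by
    have h := Complex.isPrimitiveRoot_exp N (by omega)
    rw [hζ, ← Complex.exp_nat_mul]
    convert h using 2
    push_cast
    ring
  have hζ0 : ζ ≠ 0 := hζ ▸ Complex.exp_ne_zero _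
  rw [← hw.sum_erase_pow_div_one_sub m hm k hk1 hk2, Finset.mul_sum]
  refine Finset.sum_congr rfl fun n _ => ?_
  rw [sin_div_sin_eq_exp_ratio N m n ζ hζ, pow_mul, pow_mul ζ m, ← pow_mul ζ 2 n, ← pow_mul ζ 2 m,
    mul_comm 2 n, mul_comm 2 m, pow_mul ζ n 2, pow_mul ζ m 2]
  have hx : ζ ^ n ≠ 0 := pow_ne_zero _ hζ0
  have hy : ζ ^ m ≠ 0 := pow_ne_zero _ hζ0
  generalize ζ ^ n = x at hx ⊢
  generalize ζ ^ m = y at hy ⊢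
  obtain ⟨j, rfl⟩ := Nat.exists_eq_add_of_le' hk1
  have e1 : y / x - x / y = (y ^ 2 - x ^ 2) / (x * y) := by
    field_simp
  have e2 : 1 - x ^ 2 / y ^ 2 = (y ^ 2 - x ^ 2) / y ^ 2 := by
    field_simp
  have e3 : 2 * (j + 1) - 1 = 2 * j + 1 := by omega
  have e4 : y ^ (2 * j + 1) * (x ^ 2 / y ^ 2) ^ (j + 1) * y ^ 2 = x ^ (2 * j + 1) * (x * y) := by
    rw [div_pow]
    field_simp
    ring
  rw [e1, e2, e3, div_div_eq_mul_div, div_div_eq_mul_div]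
  linear_combination -(ζ - ζ⁻¹) / (y ^ 2 - x ^ 2) * e4

theorem eigenvector_quant_alternating_hilbert (N : ℕ) (hN : 2 ≤ N)
    (ζ : ℂ) (hζ : ζ = Complex.exp ((Real.pi : ℂ) * Complex.I / N))
    (k : ℕ) (hk1 : 1 ≤ k) (hk2 : k ≤ N) :
    (∀ m ∈ Finset.Icc 1 N,
      ∑ n ∈ (Finset.Icc 1 N).erase m,
        ((Real.sin (Real.pi / N) / Real.sin (Real.pi * ((m : ℝ) - (n : ℝ)) / N) : ℝ) : ℂ) *
          ζ ^ (n * (2 * k - 1)) =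
      (ζ - ζ⁻¹) * ζ ^ (m * (2 * k - 1)) * ((k : ℂ) - ((N : ℂ) + 1) / 2)) ∧
    ∀ A : Matrix (Fin N) (Fin N) ℂ,
      (∀ m n : Fin N, A m n = if m = n then 0
        else ((Real.sin (Real.pi / N) / Real.sin (Real.pi * ((m : ℝ) - (n : ℝ)) / N) : ℝ) : ℂ)) →
      A.mulVec (fun m : Fin N => ζ ^ (((m : ℕ) + 1) * (2 * k - 1))) =
        (2 * Complex.I * Real.sin (Real.pi / N) * ((k : ℂ) - ((N : ℂ) + 1) / 2)) •
          (fun m : Fin N => ζ ^ (((m : ℕ) + 1) * (2 * k - 1))) := by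
  have main := sum_quant_alternating_hilbert_eq N ζ hζ k hk1 hk2
  refine ⟨main, fun A hA => ?_⟩
  ext m
  have hm : (m : ℕ) + 1 ∈ Finset.Icc 1 N := by
    simp only [Finset.mem_Icc]
    omega
  have h2 := two_I_mul_sin_eq_exp_sub_inv ((Real.pi : ℂ) / N)
  rw [div_mul_eq_mul_div, ← hζ] at h2
  have hsum := main (m + 1) hm
  rw [← h2] at hsum
  simp only [Matrix.mulVec, dotProduct, Pi.smul_apply, smul_eq_mul, hA]
  push_cast at hsum ⊢
  rw [mul_right_comm, ← hsum, Finset.sum_erase_eq_sub hm]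
  rw [← Finset.Ico_succ_right_eq_Icc, Order.succ_eq_add_one, ← Finset.sum_Ico_add' _ 0 N 1,
    Nat.Ico_zero_eq_range, Finset.sum_range]
  push_cast
  simp only [sub_self, mul_zero, zero_div, Complex.sin_zero, div_zero, zero_mul, sub_zero]
  refine Finset.sum_congr rfl fun n _ => ?_
  split_ifs with h
  · simp [h]
  · rw [add_sub_add_right_eq_sub]
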